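/- For every e = (e_1,...,e_r) ∈ Δ_{r,n}, the number of vectors x ∈ Q^{r,n} with shape(x) = e equals v_e = (n! / (e_0! e_1! ⋯ e_r!)) · (q−1)^{|e|} · q^{|e|'−|e|}, where e_0 = n − |e|. -/

import Mathlib

open Finset

/-- The ordered Hamming (NRT) space: vectors over `ZMod q` written as `n` blocks of length `r`. -/
abbrev OVec (q r n : ℕ) : Type := Fin n → Fin r → ZMod q

/-- `oshape q r n x i` is the number of blocks of `x` whose rightmost nonzero entry is in
(0-based) position `i`, i.e. position `i+1` counting from the beginning of the block. -/
def oshape (q r n : ℕ) (x : OVec q r n) (i : Fin r) : ℕ :=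
  (Finset.univ.filter fun b : Fin n =>
    x b i ≠ 0 ∧ ∀ j : Fin r, i < j → x b j = 0).card

/-- `v_e = (n!/(e₀!e₁!⋯e_r!)) (q-1)^{|e|} q^{|e|'-|e|}`, where `e₀ = n - |e|` and
`|e|' - |e| = ∑ i·e_{i+1}` (0-based). -/
def vnum (q r n : ℕ) (e : Fin r → ℕ) : ℕ :=
  Nat.multinomial Finset.univ (Fin.cons (n - ∑ i, e i) e) *
    (q - 1) ^ (∑ i, e i) * q ^ (∑ i : Fin r, (i : ℕ) * e i)

/-- The number of words in `α` of length `n` in which each colour `k` occurs `c k` times. -/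
theorem card_filter_colour_counts {α κ : Type*} [Fintype α] [Fintype κ]
    [DecidableEq κ] (f : α → κ) (n : ℕ) (c : κ → ℕ) (hc : ∑ k, c k = n) :
    #{x : Fin n → α | ∀ k, #{b | f (x b) = k} = c k}
      = Nat.multinomial univ c * ∏ k, #{a | f a = k} ^ c k := by
  have hl : (∑ a, MvPolynomial.X (f a) : MvPolynomial κ ℕ) ^ n
      = ∑ x : Fin n → α, MvPolynomial.monomial
          (Finsupp.equivFunOnFinite.symm fun k => #{b | f (x b) = k}) 1 := by
    rw [Fintype.sum_pow]
    refine sum_congr rfl fun x _ => ?_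
    rw [← Finset.prod_fiberwise univ (fun b => f (x b)), MvPolynomial.monomial_eq,
      Finsupp.prod_fintype _ _ (by simp)]
    simp only [map_one, one_mul]
    refine prod_congr rfl fun k _ => ?_
    rw [prod_congr rfl (g := fun _ => MvPolynomial.X k) (by simp +contextual)]
    simp
  have hr : (∑ a, MvPolynomial.X (f a) : MvPolynomial κ ℕ) ^ n
      = ∑ d ∈ piAntidiag univ n, MvPolynomial.monomial (Finsupp.equivFunOnFinite.symm d)
          (Nat.multinomial univ d * ∏ k, #{a | f a = k} ^ d k) := by
    rw [← Finset.sum_fiberwise univ f, Finset.sum_pow_eq_sum_piAntidiag]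
    refine sum_congr rfl fun d _ => ?_
    rw [MvPolynomial.monomial_eq, Finsupp.prod_fintype _ _ (by simp), map_mul, map_prod,
      mul_assoc, ← prod_mul_distrib]
    congr 1
    refine prod_congr rfl fun k _ => ?_
    rw [sum_congr rfl (g := fun _ => MvPolynomial.X k) (by simp +contextual)]
    simp [mul_pow]
  have h := congrArg (MvPolynomial.coeff (Finsupp.equivFunOnFinite.symm c)) (hl.symm.trans hr)
  simp only [MvPolynomial.coeff_sum, MvPolynomial.coeff_monomial,
    EmbeddingLike.apply_eq_iff_eq, funext_iff] at h
  simp only [← funext_iff, sum_ite_eq', mem_piAntidiag, hc] at h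
  simpa [funext_iff] using h

/-- The 1-based position of the last nonzero entry of a block, or `0` for the zero block. -/
noncomputable def blockHeight {q r : ℕ} (a : Fin r → ZMod q) : Fin (r + 1) :=
  univ.sup fun j => if a j = 0 then 0 else j.succ

theorem blockHeight_le_iff {q r : ℕ} (a : Fin r → ZMod q) (k : Fin (r + 1)) :
    blockHeight a ≤ k ↔ ∀ j, a j ≠ 0 → j.succ ≤ k := by
  simp only [blockHeight, Finset.sup_le_iff, mem_univ, true_imp_iff]
  refine forall_congr' fun j => ?_
  split_ifs with h <;> simp [h]

theorem blockHeight_eq_zero_iff {q r : ℕ} (a : Fin r → ZMod q) :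
    blockHeight a = 0 ↔ a = 0 := by
  rw [← Fin.le_zero_iff, blockHeight_le_iff, funext_iff]
  refine forall_congr' fun j => ?_
  simp [Fin.succ_ne_zero]

theorem blockHeight_eq_succ_iff {q r : ℕ} (a : Fin r → ZMod q) (i : Fin r) :
    blockHeight a = i.succ ↔ a i ≠ 0 ∧ ∀ j, i < j → a j = 0 := by
  have key : ∀ j, a j ≠ 0 → j.succ ≤ blockHeight a := (blockHeight_le_iff a _).1 le_rfl
  constructor
  · intro h
    have hz : ∀ j, i < j → a j = 0 := fun j hj => by
      by_contra hne
      have := key j hne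
      rw [h, Fin.succ_le_succ_iff] at this
      exact absurd hj this.not_gt
    refine ⟨fun h0 => ?_, hz⟩
    have : blockHeight a ≤ i.castSucc := by
      refine (blockHeight_le_iff a _).2 fun j hj => ?_
      rcases lt_trichotomy j i with hji | rfl | hij
      · exact Fin.succ_le_castSucc_iff.2 hji
      · exact absurd h0 hj
      · exact absurd (hz j hij) hj
    rw [h] at this
    exact absurd this (Fin.castSucc_lt_succ).not_ge
  · rintro ⟨h0, hz⟩
    refine le_antisymm ((blockHeight_le_iff a _).2 fun j hj => ?_) (key i h0)
    rw [Fin.succ_le_succ_iff]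
    by_contra hij
    exact hj (hz j (not_le.1 hij))

theorem card_blockHeight_eq_zero (q r : ℕ) [NeZero q] :
    #{a : Fin r → ZMod q | blockHeight a = 0} = 1 := by
  simp [blockHeight_eq_zero_iff, filter_eq']

theorem card_blockHeight_eq_succ (q r : ℕ) [NeZero q] (i : Fin r) :
    #{a : Fin r → ZMod q | blockHeight a = i.succ} = (q - 1) * q ^ (i : ℕ) := by
  have : ({a : Fin r → ZMod q | blockHeight a = i.succ} : Finset _) = Fintype.piFinset
      fun j => if j < i then univ else if j = i then univ.erase 0 else {0} := by
    ext a
    simp only [mem_filter, mem_univ, true_and, Fintype.mem_piFinset, blockHeight_eq_succ_iff]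
    constructor
    · rintro ⟨h0, hz⟩ j
      rcases lt_trichotomy j i with h | rfl | h
      · simp [h]
      · simp [h0]
      · simp [h.not_gt, h.ne', hz j h]
    · intro h
      exact ⟨by simpa using h i, fun j hj => by simpa [hj.not_gt, hj.ne'] using h j⟩
  rw [this, Fintype.card_piFinset]
  have : ∀ j : Fin r, #(if j < i then (univ : Finset (ZMod q))
      else if j = i then univ.erase 0 else {0})
        = (if j = i then q - 1 else 1) * if j < i then q else 1 := fun j => by
    rcases lt_trichotomy j i with h | rfl | h
    · simp [h, h.ne, ZMod.card]
    · simp [ZMod.card]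
    · simp [h.not_gt, h.ne']
  rw [prod_congr rfl fun j _ => this j, prod_mul_distrib, prod_ite_eq' univ i,
    ← prod_filter, prod_const, filter_gt_eq_Iio, Fin.card_Iio]
  simp

theorem stmt0 (q r n : ℕ) [NeZero q] (hq : 2 ≤ q) (hr : 1 ≤ r) (hn : 1 ≤ n)
    (e : Fin r → ℕ) (he : ∑ i, e i ≤ n) :
    (Finset.univ.filter fun x : OVec q r n => ∀ i, oshape q r n x i = e i).card
      = vnum q r n e := by
  have hc : ∑ k, (Fin.cons (n - ∑ i, e i) e : Fin (r + 1) → ℕ) k = n := by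
    simp [Fin.sum_univ_succ, he]
  have hset : ∀ x : OVec q r n, (∀ i, oshape q r n x i = e i) ↔
      ∀ k, #{b | blockHeight (x b) = k}
        = (Fin.cons (n - ∑ i, e i) e : Fin (r + 1) → ℕ) k := fun x => by
    have hsum : ∑ k, #{b | blockHeight (x b) = k} = n := by
      simpa using (card_eq_sum_card_fiberwise (s := (univ : Finset (Fin n)))
        (f := fun b => blockHeight (x b)) (t := univ) (by simp)).symm
    rw [Fin.sum_univ_succ] at hsum
    rw [Fin.forall_fin_succ]
    simp only [Fin.cons_zero, Fin.cons_succ, blockHeight_eq_succ_iff, oshape] at hsum ⊢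
    refine ⟨fun h => ⟨?_, h⟩, fun h => h.2⟩
    simp only [h] at hsum
    omega
  have hcard := card_filter_colour_counts (blockHeight (q := q)) n _ hc
  simp only [← hset] at hcard
  rw [filter_congr_decidable] at hcard
  rw [hcard, vnum, mul_assoc, Fin.prod_univ_succ]
  simp only [Fin.cons_zero, Fin.cons_succ, card_blockHeight_eq_zero, card_blockHeight_eq_succ,
    one_pow, one_mul, mul_pow, prod_mul_distrib, prod_pow_eq_pow_sum, ← pow_mul]
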